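/- Let G be a finite 2-group with property L_2. Then G is cyclic, or G is isomorphic to a generalized quaternion group Q_{2^k} for some k ≥ 3. -/

import Mathlib

/-- The natural reduction ring homomorphism `W₂(k) → k` from length-two `p`-typical
Witt vectors to `k`, given by the zeroth coefficient. -/
noncomputable def wittReduce (p : ℕ) [Fact p.Prime] (k : Type*) [CommRing k] :
    TruncatedWittVector p 2 k →+* k :=
  RingHom.liftOfRightInverse (WittVector.truncate 2) TruncatedWittVector.out
    TruncatedWittVector.truncateFun_out
    ⟨WittVector.constantCoeff, fun x hx => by
      rw [WittVector.mem_ker_truncate] at hx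
      simpa [RingHom.mem_ker] using hx 0 (by norm_num)⟩

/-- A finite group `G` has property `L_p` if every homomorphism `G → GL_n(k)`, for `k` a
finite field of characteristic `p`, lifts to `GL_n(W₂(k))`. -/
def HasLp (p : ℕ) [Fact p.Prime] (G : Type*) [Group G] : Prop :=
  ∀ (n : ℕ), 1 ≤ n → ∀ (k : Type) [Field k] [Fintype k] [CharP k p],
    ∀ f : G →* GL (Fin n) k,
      ∃ g : G →* GL (Fin n) (TruncatedWittVector p 2 k),
        (Matrix.GeneralLinearGroup.map (wittReduce p k)).comp g = f

/-- A group has property `L` if it has property `L_p` for every prime `p`. -/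
def HasL (G : Type*) [Group G] : Prop :=
  ∀ (p : ℕ) [Fact p.Prime], HasLp p G

section WittVectors

variable {p : ℕ} [Fact p.Prime] {k : Type*} [CommRing k]

theorem wittReduce_truncate (x : WittVector p k) :
    wittReduce p k (WittVector.truncate 2 x) = x.coeff 0 :=
  RingHom.liftOfRightInverse_comp_apply _ _ _ _ _

theorem wittReduce_surjective : Function.Surjective (wittReduce p k) := fun c =>
  ⟨WittVector.truncate 2 (WittVector.teichmuller p c), by simp [wittReduce_truncate]⟩

/-- The kernel of `W₂(k) → k` has square zero. -/
theorem mul_eq_zero_of_wittReduce_eq_zero [CharP k p] {x y : TruncatedWittVector p 2 k}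
    (hx : wittReduce p k x = 0) (hy : wittReduce p k y = 0) : x * y = 0 := by
  obtain ⟨x, rfl⟩ := WittVector.truncate_surjective p 2 k x
  obtain ⟨y, rfl⟩ := WittVector.truncate_surjective p 2 k y
  rw [wittReduce_truncate] at hx hy
  have hx' : x = WittVector.verschiebung (x.shift 1) :=
    WittVector.eq_iterate_verschiebung (n := 1) (by simpa using hx)
  have hy' : y = WittVector.verschiebung (y.shift 1) :=
    WittVector.eq_iterate_verschiebung (n := 1) (by simpa using hy)
  rw [← map_mul, ← RingHom.mem_ker, WittVector.mem_ker_truncate, hx',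
    ← WittVector.verschiebung_mul_frobenius, hy', WittVector.frobenius_verschiebung, ← mul_assoc]
  intro i hi
  interval_cases i
  · exact WittVector.verschiebung_coeff_zero _
  · exact (WittVector.verschiebung_coeff_succ _ 0).trans (WittVector.mul_charP_coeff_zero _)

theorem natCast_truncatedWittVector_two_ne_zero [CharP k p] [Nontrivial k] :
    (p : TruncatedWittVector p 2 k) ≠ 0 := by
  rw [← map_natCast (WittVector.truncate 2), Ne, ← RingHom.mem_ker, WittVector.mem_ker_truncate]
  intro h
  exact one_ne_zero ((WittVector.coeff_p_one p k).symm.trans (h 1 one_lt_two))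

end WittVectors

section Lifting

/-- Property `L_p` for matrix representations with an arbitrary finite index type. -/
theorem HasLp.exists_lift {p : ℕ} [Fact p.Prime] {G : Type*} [Group G] (hG : HasLp p G)
    {k : Type} [Field k] [Fintype k] [CharP k p] {ι : Type*} [Fintype ι] [DecidableEq ι]
    [Nonempty ι] (f : G →* Matrix ι ι k) :
    ∃ g : G →* Matrix ι ι (TruncatedWittVector p 2 k),
      ∀ x, (g x).map (wittReduce p k) = f x := by
  let e := Fintype.equivFin ι
  obtain ⟨g, hg⟩ := hG (Fintype.card ι) Fintype.card_pos k
    (((Matrix.reindexRingEquiv k e).toMonoidHom.comp f).toHomUnits)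
  refine ⟨(Matrix.reindexRingEquiv _ e.symm).toMonoidHom.comp ((Units.coeHom _).comp g),
    fun x => ?_⟩
  ext i j
  have h := congrArg (fun M : GL _ k => M.1 (e i) (e j)) (DFunLike.congr_fun hg x)
  simpa using h

/-- The representation of `G` induced from a matrix representation of a subgroup `H`, in a basis
adapted to the decomposition into cosets: on `H`, the block of the trivial coset is a direct
summand affording the original representation. -/
theorem exists_induced_matrix_representation {G : Type*} [Group G] (H : Subgroup G)
    [Fintype (G ⧸ H)] [DecidableEq (G ⧸ H)] {R : Type*} [CommRing R]
    {ι : Type*} [Fintype ι] [DecidableEq ι] (ρ : H →* Matrix ι ι R) :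
    ∃ f : G →* Matrix ((G ⧸ H) × ι) ((G ⧸ H) × ι) R, ∀ h : H,
      (∀ i j, f h ((1 : G), i) ((1 : G), j) = ρ h i j) ∧
      ∀ q : G ⧸ H, q ≠ (1 : G) → ∀ i j,
        f h ((1 : G), i) (q, j) = 0 ∧ f h (q, i) ((1 : G), j) = 0 := by
  obtain ⟨s, hs, hs1⟩ : ∃ s : G ⧸ H → G, (∀ q, (s q : G ⧸ H) = q) ∧ s (1 : G) = 1 := by
    refine ⟨Function.update Quotient.out ((1 : G) : G ⧸ H) 1, fun q => ?_, by simp⟩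
    by_cases hq : q = (1 : G)
    · subst hq; simp
    · simp [Function.update_of_ne hq]
  have hc (g : G) (q : G ⧸ H) : (s (g • q))⁻¹ * (g * s q) ∈ H := by
    rw [← QuotientGroup.eq, hs, ← smul_eq_mul, ← MulAction.Quotient.smul_coe, hs]
  let c (g : G) (q : G ⧸ H) : H := ⟨(s (g • q))⁻¹ * (g * s q), hc g q⟩
  have hc1 (q : G ⧸ H) : c 1 q = 1 := by ext; simp [c]
  have hcmul (g g' : G) (q : G ⧸ H) : c (g * g') q = c g (g' • q) * c g' q := by
    ext; simp [c, mul_smul, mul_assoc]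
  refine ⟨⟨⟨fun g => Matrix.of fun x y => if x.1 = g • y.1 then ρ (c g y.1) x.2 y.2 else 0, ?_⟩,
    ?_⟩, fun h => ⟨fun i j => ?_, fun q hq i j => ?_⟩⟩
  · ext ⟨q, i⟩ ⟨q', j⟩
    simp only [Matrix.of_apply, one_smul, hc1, map_one, Matrix.one_apply, Prod.mk.injEq]
    split_ifs <;> simp_all
  · intro g g'
    ext ⟨q, i⟩ ⟨q', j⟩
    rw [Matrix.mul_apply, Fintype.sum_prod_type, Finset.sum_eq_single (g' • q')]
    · simp only [Matrix.of_apply, mul_smul, hcmul, map_mul, if_true]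
      split_ifs <;> simp [Matrix.mul_apply]
    · intro b _ hb
      simp [hb]
    · simp
  · have h1 : (h : G) • ((1 : G) : G ⧸ H) = (1 : G) := by
      rw [MulAction.Quotient.smul_coe, QuotientGroup.eq]; simp
    have h2 : c h ((1 : G) : G ⧸ H) = h := by ext; simp only [c, h1]; simp [hs1]
    simp [h1, h2]
  · have h2 : (h : G) • ((1 : G) : G ⧸ H) = (1 : G) := by
      rw [MulAction.Quotient.smul_coe, QuotientGroup.eq]; simp
    refine ⟨if_neg fun h0 => hq ?_, if_neg fun h0 => hq (h0.trans h2)⟩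
    have h1 : ((h⁻¹ : H) : G) • ((1 : G) : G ⧸ H) = (1 : G) := by
      rw [MulAction.Quotient.smul_coe, QuotientGroup.eq]; simp
    rw [← inv_smul_smul (h : G) q, ← show ((1 : G) : G ⧸ H) = (h : G) • q from h0]
    simpa using h1

/-- Property `L_p` passes to subgroups, for matrix representations: a lift of the induced
representation restricts to `H`, and since the kernel of `W₂(k) → k` has square zero, its block at
the trivial coset is again multiplicative. -/
theorem HasLp.exists_lift_subgroup {p : ℕ} [Fact p.Prime] {G : Type*} [Group G] [Finite G]
    (hG : HasLp p G) (H : Subgroup G) {k : Type} [Field k] [Fintype k] [CharP k p]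
    {ι : Type*} [Fintype ι] [DecidableEq ι] [Nonempty ι] (ρ : H →* Matrix ι ι k) :
    ∃ g : H →* Matrix ι ι (TruncatedWittVector p 2 k),
      ∀ x, (g x).map (wittReduce p k) = ρ x := by
  classical
  have := Fintype.ofFinite (G ⧸ H)
  obtain ⟨f, hf⟩ := exists_induced_matrix_representation H ρ
  obtain ⟨F, hF⟩ := hG.exists_lift f
  have hred (x : G) (a b) : wittReduce p k (F x a b) = f x a b := by rw [← hF]; rfl
  refine ⟨⟨⟨fun h => Matrix.of fun i j => F h ((1 : G), i) ((1 : G), j), ?_⟩, ?_⟩, fun h => ?_⟩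
  · ext i j
    simp [Matrix.one_apply]
  · intro h h'
    ext i j
    simp only [Matrix.of_apply, Subgroup.coe_mul, map_mul, Matrix.mul_apply,
      Fintype.sum_prod_type]
    rw [Fintype.sum_eq_single ((1 : G) : G ⧸ H)]
    refine fun q hq => Finset.sum_eq_zero fun l _ => ?_
    exact mul_eq_zero_of_wittReduce_eq_zero ((hred _ _ _).trans ((hf h).2 q hq _ _).1)
      ((hred _ _ _).trans ((hf h').2 q hq _ _).2)
  · ext i j
    simp [hred, (hf h).1]

end Lifting

section KleinFour

/-- Two commuting involutions over a square-zero extension `π : R → k` with `2 ≠ 0` in `R` cannot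
reduce to the unipotent matrices with upper right entries `1` and `ω ≠ 0, 1`. -/
theorem not_commute_of_map_eq_unipotent {R k : Type*} [CommRing R] [Field k] [CharP k 2]
    (π : R →+* k) (hπ : Function.Surjective π) (hker : ∀ x y, π x = 0 → π y = 0 → x * y = 0)
    (h2 : (2 : R) ≠ 0) {ω : k} (hω0 : ω ≠ 0) (hω1 : ω ≠ 1) {A B : Matrix (Fin 2) (Fin 2) R}
    (hA : A * A = 1) (hB : B * B = 1) (hAπ : A.map π = !![1, 1; 0, 1])
    (hBπ : B.map π = !![1, ω; 0, 1]) : A * B ≠ B * A := by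
  have hπ2 : π 2 = 0 := by rw [map_ofNat]; exact CharTwo.two_eq_zero
  have hunit {x : R} (hx : π x ≠ 0) : IsUnit x := by
    obtain ⟨y, hy⟩ := hπ (π x)⁻¹
    have h0 : π (x * y - 1) = 0 := by simp [hy, hx]
    exact IsUnit.of_mul_eq_one (y * (2 - x * y)) (by linear_combination -hker _ _ h0 h0)
  have shape {M : Matrix (Fin 2) (Fin 2) R} {c : k} (hc : c ≠ 0) (hM : M * M = 1)
      (hMπ : M.map π = !![1, c; 0, 1]) :
      M 1 0 = 0 ∧ M 1 1 = -M 0 0 ∧ 2 * M 0 0 = 2 := by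
    have e00 : π (M 0 0) = 1 := congrFun₂ hMπ 0 0
    have e01 : π (M 0 1) = c := congrFun₂ hMπ 0 1
    have hu : IsUnit (M 0 1) := hunit (by rwa [e01])
    have m00 := congrFun₂ hM 0 0
    have m01 := congrFun₂ hM 0 1
    simp only [Matrix.mul_apply, Fin.sum_univ_two, Matrix.one_apply_eq, ne_eq, zero_ne_one,
      not_false_eq_true, Matrix.one_apply_ne] at m00 m01
    have h1 := hker (1 - M 0 0) (1 + M 0 0) (by simp [e00])
      (by rw [map_add, e00, map_one]; exact CharTwo.add_self_eq_zero 1)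
    refine ⟨hu.mul_right_eq_zero.1 (by linear_combination m00 + h1), ?_, ?_⟩
    · exact eq_neg_of_add_eq_zero_right (hu.mul_right_eq_zero.1 (by linear_combination m01))
    · linear_combination hker 2 (M 0 0 - 1) hπ2 (by simp [e00])
  obtain ⟨-, hA1, hA2⟩ := shape one_ne_zero hA hAπ
  obtain ⟨-, hB1, hB2⟩ := shape hω0 hB hBπ
  intro h
  have h01 := congrFun₂ h 0 1
  simp only [Matrix.mul_apply, Fin.sum_univ_two] at h01
  have eA : π (A 0 1) = 1 := congrFun₂ hAπ 0 1
  have eB : π (B 0 1) = ω := congrFun₂ hBπ 0 1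
  have hu : IsUnit (B 0 1 - A 0 1) := hunit (by rw [map_sub, eA, eB]; exact sub_ne_zero.2 hω1)
  refine h2 (hu.mul_left_eq_zero.1 ?_)
  rw [hA1, hB1] at h01
  linear_combination h01 - B 0 1 * hA2 + A 0 1 * hB2

/-- The homomorphism from the Klein four-group determined by two commuting elements of square
one. -/
def kleinFourHom {G : Type*} [Group G] {a b : G} (ha : a * a = 1) (hb : b * b = 1)
    (hab : Commute a b) : Multiplicative (ZMod 2 × ZMod 2) →* G :=
  MonoidHom.mk' (fun v => a ^ v.toAdd.1.val * b ^ v.toAdd.2.val) fun v w => by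
    have key {g : G} (hg : g * g = 1) (x y : ZMod 2) :
        g ^ (x + y).val = g ^ x.val * g ^ y.val := by
      rw [ZMod.val_add, ← pow_add, ← pow_mod_orderOf g (x.val + y.val),
        ← Nat.mod_mod_of_dvd _ (orderOf_dvd_of_pow_eq_one ((sq g).trans hg)), pow_mod_orderOf]
    rw [toAdd_mul, Prod.fst_add, Prod.snd_add, key ha, key hb]
    exact (hab.pow_pow _ _).mul_mul_mul_comm _ _

theorem kleinFourHom_injective {G : Type*} [Group G] {a b : G} (ha : a * a = 1) (hb : b * b = 1)
    (hab : Commute a b) (ha1 : a ≠ 1) (hb1 : b ≠ 1) (hne : a ≠ b) :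
    Function.Injective (kleinFourHom ha hb hab) := by
  rw [injective_iff_map_eq_one]
  rintro ⟨x, y⟩ h
  change a ^ x.val * b ^ y.val = 1 at h
  have : a * b ≠ 1 := fun h => hne (mul_right_cancel (h.trans hb.symm))
  fin_cases x <;> fin_cases y <;> (simp_all [ZMod.val]; try rfl)

theorem exists_ne_zero_one_galoisField : ∃ ω : GaloisField 2 2, ω ≠ 0 ∧ ω ≠ 1 := by
  by_contra! h
  have hcard := GaloisField.card 2 2 two_ne_zero
  have : Function.Surjective (fun i : Fin 2 => if i = 0 then (0 : GaloisField 2 2) else 1) := by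
    intro ω
    by_cases hω : ω = 0
    · exact ⟨0, by simp [hω]⟩
    · exact ⟨1, by simp [h ω hω]⟩
  have := Nat.card_le_card_of_surjective _ this
  simp [hcard] at this

/-- In a finite group with property `L_2`, commuting involutions coincide. -/
theorem HasLp.eq_of_commute_of_mul_self_eq_one {G : Type*} [Group G] [Finite G] (hG : HasLp 2 G)
    {a b : G} (ha : a * a = 1) (hb : b * b = 1) (hab : Commute a b) (ha1 : a ≠ 1) (hb1 : b ≠ 1) :
    a = b := by
  by_contra hne
  obtain ⟨ω, hω0, hω1⟩ := exists_ne_zero_one_galoisField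
  have := Fintype.ofFinite (GaloisField 2 2)
  let φ := MonoidHom.ofInjective (kleinFourHom_injective ha hb hab ha1 hb1 hne)
  let θ (v : ZMod 2 × ZMod 2) : GaloisField 2 2 :=
    algebraMap (ZMod 2) _ v.1 + algebraMap (ZMod 2) _ v.2 * ω
  let ρ : Multiplicative (ZMod 2 × ZMod 2) →* Matrix (Fin 2) (Fin 2) (GaloisField 2 2) :=
    { toFun v := !![1, θ v.toAdd; 0, 1]
      map_one' := by simp [θ, Matrix.one_fin_two]
      map_mul' v w := by
        simp only [θ, toAdd_mul, Prod.fst_add, Prod.snd_add, map_add, Matrix.mul_fin_two]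
        congr! 3 <;> simp
        ring }
  obtain ⟨g, hg⟩ := hG.exists_lift_subgroup (kleinFourHom ha hb hab).range
    (ρ.comp φ.symm.toMonoidHom)
  let F := g.comp φ.toMonoidHom
  have hF (v) : (F v).map (wittReduce 2 (GaloisField 2 2)) = ρ v := by simp [F, hg]
  have hsq (v) : F v * F v = 1 := by
    rw [← map_mul, ← map_one F]
    congr 1
    exact CharTwo.add_self_eq_zero (R := ZMod 2 × ZMod 2) v
  refine not_commute_of_map_eq_unipotent (wittReduce 2 (GaloisField 2 2)) wittReduce_surjective
    (fun _ _ => mul_eq_zero_of_wittReduce_eq_zero)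
    (mod_cast natCast_truncatedWittVector_two_ne_zero (p := 2)) hω0 hω1
    (hsq (.ofAdd (1, 0))) (hsq (.ofAdd (0, 1))) ?_ ?_ ?_
  · rw [hF]; simp [ρ, θ]
  · rw [hF]; simp [ρ, θ]
  · exact (Commute.all _ _).map F

end KleinFour

section UniqueInvolution

theorem odd_or_dvd_add_one_of_forall_not_dvd {m : ℕ} (hm : 1 ≤ m) {r s : ℤ}
    (hs : (2 ^ m : ℤ) ∣ s * (r - 1)) (hr : (2 ^ m : ℤ) ∣ r * r - 1)
    (h : ∀ i : ℤ, ¬ (2 ^ m : ℤ) ∣ i * (1 + r) + s) :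
    Odd s ∨ 2 ≤ m ∧ (2 ^ m : ℤ) ∣ r + 1 ∧ (2 ^ m : ℤ) ∣ s - 2 ^ (m - 1) := by
  obtain ⟨n, rfl⟩ : ∃ n, m = n + 1 := ⟨m - 1, by omega⟩
  rw [← Int.not_even_iff_odd, or_iff_not_imp_left, not_not]
  rintro ⟨t, rfl⟩
  have hodd : Odd r := by
    have h2 : (2 : ℤ) ∣ r * r - 1 := (dvd_pow_self 2 n.succ_ne_zero).trans hr
    by_contra hr'
    obtain ⟨c, rfl⟩ := Int.not_odd_iff_even.1 hr'
    have : (2 : ℤ) ∣ 1 := by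
      have h3 : (2 : ℤ) ∣ (c + c) * (c + c) := ⟨c * (c + c), by ring⟩
      simpa using dvd_sub h3 h2
    omega
  obtain ⟨u, rfl⟩ : ∃ u, r = 2 * u - 1 := by
    obtain ⟨c, rfl⟩ := hodd
    exact ⟨c + 1, by ring⟩
  have hcop {v : ℤ} (hv : Odd v) : IsCoprime ((2 : ℤ) ^ n) v :=
    (Int.isCoprime_two_left.2 hv).pow_left
  have hu : Even u := by
    by_contra hu
    obtain ⟨a, b, hab⟩ := hcop (Int.not_even_iff_odd.1 hu)
    exact h (-b * t) ⟨t * a, by rw [pow_succ]; linear_combination 2 * t * (-hab)⟩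
  have hv : Odd (u - 1) := hu.sub_odd odd_one
  have hts : (2 : ℤ) ^ n ∣ t + t := by
    refine (hcop hv).dvd_of_dvd_mul_right ?_
    rw [pow_succ] at hs
    exact Int.dvd_of_mul_dvd_mul_right two_ne_zero (by convert hs using 1; ring)
  have hur : (2 : ℤ) ^ n ∣ 2 * u := by
    refine (hcop hv).dvd_of_dvd_mul_right ?_
    rw [pow_succ] at hr
    exact Int.dvd_of_mul_dvd_mul_right two_ne_zero (by convert hr using 1; ring)
  obtain ⟨c, hc⟩ := hts
  obtain ⟨d, hd⟩ := hur
  have hcodd : Odd c := by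
    by_contra hc'
    obtain ⟨e, rfl⟩ := Int.not_odd_iff_even.1 hc'
    exact h 0 ⟨e, by rw [pow_succ]; linear_combination hc⟩
  have hdeven : Even d := by
    by_contra hd'
    obtain ⟨e, he⟩ := hcodd.add_odd (Int.not_even_iff_odd.1 hd')
    exact h 1 ⟨e, by rw [pow_succ]; linear_combination hc + hd + 2 ^ n * he⟩
  refine ⟨?_, ?_, ?_⟩
  · by_contra hn
    obtain rfl : n = 0 := by omega
    obtain ⟨e, rfl⟩ := hcodd
    omega
  · obtain ⟨e, rfl⟩ := hdeven
    exact ⟨e, by rw [pow_succ]; linear_combination hd⟩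
  · obtain ⟨e, rfl⟩ := hcodd
    exact ⟨e, by rw [pow_succ, Nat.add_sub_cancel]; linear_combination hc⟩

variable {G : Type*} [Group G]

theorem conj_zpow_eq_zpow_mul {x y : G} {r : ℤ} (hr : y * x * y⁻¹ = x ^ r) (i : ℤ) :
    y * x ^ i * y⁻¹ = x ^ (r * i) := by
  rw [← conj_zpow, hr, zpow_mul]

theorem sq_conj_eq_zpow_mul_self {x y : G} {r : ℤ} (hr : y * x * y⁻¹ = x ^ r) :
    y ^ 2 * x * (y ^ 2)⁻¹ = x ^ (r * r) := by
  rw [← conj_zpow_eq_zpow_mul hr r, ← hr, sq]; group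

theorem mem_zpowers_zpow_of_odd {x : G} {m : ℕ} (hx : orderOf x = 2 ^ m) {s : ℤ} (hs : Odd s) :
    x ∈ Subgroup.zpowers (x ^ s) := by
  rw [mem_zpowers_zpow_iff, hx, ← Int.isCoprime_iff_gcd_eq_one]
  push_cast
  exact (Int.isCoprime_two_right.2 hs).pow_right

/-- The group `G` has at most one element of order two. -/
def UniqueInvolution (G : Type*) [Group G] : Prop :=
  ∀ a b : G, orderOf a = 2 → orderOf b = 2 → a = b

namespace UniqueInvolution

variable {x y : G} {m : ℕ}

theorem odd_or_inverts (hG : UniqueInvolution G) (hm : 1 ≤ m) (hx : orderOf x = 2 ^ m)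
    (hy : y ∉ Subgroup.zpowers x) {r s : ℤ} (hr : y * x * y⁻¹ = x ^ r) (hs : y ^ 2 = x ^ s) :
    Odd s ∨ 2 ≤ m ∧ y * x * y⁻¹ = x⁻¹ ∧ y ^ 2 = x ^ 2 ^ (m - 1) := by
  have hdvd (i j : ℤ) : (2 ^ m : ℤ) ∣ i - j ↔ x ^ i = x ^ j := by
    rw [← mul_inv_eq_one, ← zpow_sub, ← orderOf_dvd_iff_zpow_eq_one, hx]; norm_cast
  have key := odd_or_dvd_add_one_of_forall_not_dvd hm (r := r) (s := s) ?_ ?_ ?_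
  · refine key.imp_right fun ⟨h1, h2, h3⟩ => ⟨h1, ?_, ?_⟩
    · rw [hr, ← zpow_neg_one]
      exact (hdvd _ _).1 (by simpa using h2)
    · rw [hs, (hdvd _ _).1 h3]; norm_cast
  · rw [show s * (r - 1) = r * s - s by ring, hdvd, ← conj_zpow_eq_zpow_mul hr, ← hs]; group
  · rw [hdvd, ← sq_conj_eq_zpow_mul_self hr, hs]; group
  · intro i hi
    rw [← sub_zero (_ + _), hdvd, zpow_zero] at hi
    have h1 : orderOf (x ^ i * y) = 2 := by
      refine orderOf_eq_prime ?_ fun h => hy ?_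
      · calc (x ^ i * y) ^ 2 = x ^ i * (y * x ^ i * y⁻¹) * y ^ 2 := by rw [sq, sq]; group
          _ = 1 := by
            rw [conj_zpow_eq_zpow_mul hr, hs, ← zpow_add, ← zpow_add, ← hi]; congr 1; ring
      · rw [eq_inv_of_mul_eq_one_right h]
        exact inv_mem (Subgroup.zpow_mem_zpowers x i)
    have h2 : orderOf (x ^ 2 ^ (m - 1)) = 2 := by
      rw [orderOf_pow_of_dvd (by positivity) (hx ▸ pow_dvd_pow 2 (m.sub_le 1)), hx,
        Nat.pow_div (m.sub_le 1) two_pos, Nat.sub_sub_self hm, pow_one]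
    refine hy ((Subgroup.mul_mem_cancel_left _ (Subgroup.zpow_mem_zpowers x i)).1 ?_)
    rw [hG _ _ h1 h2]
    exact Subgroup.npow_mem_zpowers _ _

theorem mem_zpowers_of_commute (hG : UniqueInvolution G) (hx : orderOf x = 2 ^ m)
    (hy : y ∉ Subgroup.zpowers x) (hxy : Commute y x) (hy2 : y ^ 2 ∈ Subgroup.zpowers x) :
    x ∈ Subgroup.zpowers y := by
  obtain rfl | hm := Nat.eq_zero_or_pos m
  · rw [orderOf_eq_one_iff.1 (hx.trans (pow_zero 2))]
    exact one_mem _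
  obtain ⟨s, hs⟩ := hy2
  replace hs : x ^ s = y ^ 2 := hs
  have hr : y * x * y⁻¹ = x ^ (1 : ℤ) := by rw [hxy.eq]; group
  obtain h | ⟨hm2, h, -⟩ := hG.odd_or_inverts hm hx hy hr hs.symm
  · have := mem_zpowers_zpow_of_odd hx h
    rw [hs] at this
    exact Subgroup.zpowers_le.2 (Subgroup.npow_mem_zpowers y 2) this
  · rw [hr, zpow_one, eq_inv_iff_mul_eq_one, ← sq, ← orderOf_dvd_iff_pow_eq_one, hx] at h
    have := (pow_dvd_pow 2 hm2).trans h
    norm_num at this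

end UniqueInvolution

/-- A nontrivial element of a `p`-group has a power of order `p`. -/
theorem IsPGroup.exists_pow_orderOf_eq {p : ℕ} [Fact p.Prime] (hG : IsPGroup p G) {x : G}
    (hx : x ≠ 1) : ∃ n : ℕ, orderOf (x ^ n) = p := by
  obtain ⟨k, hk⟩ := (IsPGroup.iff_orderOf.1 hG) x
  obtain ⟨k, rfl⟩ : ∃ j, k = j + 1 := by
    refine Nat.exists_eq_succ_of_ne_zero ?_
    rintro rfl
    exact hx (orderOf_eq_one_iff.1 (hk.trans (pow_zero p)))
  have hp := (Fact.out : p.Prime).pos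
  refine ⟨p ^ k, ?_⟩
  rw [orderOf_pow_of_dvd (by positivity) (hk ▸ pow_dvd_pow p k.le_succ), hk,
    Nat.pow_div k.le_succ hp, Nat.succ_sub k.le_refl, Nat.sub_self, pow_one]

/-- A nontrivial normal subgroup of a finite `p`-group contains a central element of order `p`. -/
theorem IsPGroup.exists_mem_center_orderOf_eq {p : ℕ} [Fact p.Prime] [Finite G]
    (hG : IsPGroup p G) {N : Subgroup G} [N.Normal] (hN : N ≠ ⊥) :
    ∃ x ∈ N, x ∈ Subgroup.center G ∧ orderOf x = p := by
  have := (Subgroup.nontrivial_iff_ne_bot N).2 hN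
  have hdvd : p ∣ Nat.card N := by
    obtain ⟨n, hn0, hn⟩ := (hG.to_subgroup N).nontrivial_iff_card.1 this
    exact hn ▸ dvd_pow_self p hn0.ne'
  obtain ⟨b, hb, hb1⟩ :=
    (hG.of_equiv ConjAct.toConjAct).exists_fixed_point_of_prime_dvd_card_of_fixed_point
      N hdvd (a := 1) fun g => smul_one g
  have hbc : (b : G) ∈ Subgroup.center G := Subgroup.mem_center_iff.2 fun g => by
    have h := congrArg Subtype.val (hb (ConjAct.toConjAct g))
    rwa [ConjAct.Subgroup.val_conj_smul, ConjAct.toConjAct_smul, mul_inv_eq_iff_eq_mul] at h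
  obtain ⟨n, hn⟩ := hG.exists_pow_orderOf_eq (x := (b : G)) (by simpa using hb1.symm)
  exact ⟨b ^ n, pow_mem b.2 n, pow_mem hbc n, hn⟩

/-- A finite `2`-group with at most one involution has a self-centralizing normal cyclic
subgroup. -/
theorem UniqueInvolution.exists_zpowers_normal_centralizer_le [Finite G] (hG : UniqueInvolution G)
    (h2 : IsPGroup 2 G) :
    ∃ x : G, (Subgroup.zpowers x).Normal ∧
      Subgroup.centralizer (Subgroup.zpowers x : Set G) ≤ Subgroup.zpowers x := by
  obtain ⟨x, hx, hmax⟩ := Set.exists_max_image {x : G | (Subgroup.zpowers x).Normal} orderOf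
    (Set.toFinite _) ⟨1, by simp [Subgroup.normal_bot]⟩
  have hx' : (Subgroup.zpowers x).Normal := hx
  refine ⟨x, hx', ?_⟩
  by_contra hC
  set C := Subgroup.centralizer (Subgroup.zpowers x : Set G)
  let π := QuotientGroup.mk' (Subgroup.zpowers x)
  have : (C.map π).Normal := Subgroup.Normal.map inferInstance π (QuotientGroup.mk'_surjective _)
  obtain ⟨_, ⟨y, hyC, rfl⟩, hyZ, hy⟩ :=
    (h2.to_quotient (Subgroup.zpowers x)).exists_mem_center_orderOf_eq (N := C.map π)
      (by rwa [Ne, Subgroup.map_eq_bot_iff, QuotientGroup.ker_mk'])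
  have hy1 : y ∉ Subgroup.zpowers x := fun h => by
    rw [show π y = 1 from (QuotientGroup.eq_one_iff y).2 h, orderOf_one] at hy
    omega
  have hy2 : y ^ 2 ∈ Subgroup.zpowers x := by
    rw [← QuotientGroup.eq_one_iff]
    exact (map_pow π y 2).trans (hy ▸ pow_orderOf_eq_one _)
  obtain ⟨m, hm⟩ := (IsPGroup.iff_orderOf.1 h2) x
  have hxy : x ∈ Subgroup.zpowers y := hG.mem_zpowers_of_commute hm hy1
    (Subgroup.mem_centralizer_iff.1 hyC x (Subgroup.mem_zpowers x)).symm hy2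
  have hle : Subgroup.zpowers x ≤ Subgroup.zpowers y := Subgroup.zpowers_le.2 hxy
  have hnormal : (Subgroup.zpowers y).Normal := by
    refine ⟨?_⟩
    rintro _ ⟨i, rfl⟩ g
    change g * y ^ i * g⁻¹ ∈ _
    rw [← conj_zpow]
    refine zpow_mem ?_ i
    rw [← Subgroup.mul_mem_cancel_right _ (inv_mem (Subgroup.mem_zpowers y))]
    refine hle ((QuotientGroup.eq_one_iff _).1 ?_)
    change π (g * y * g⁻¹ * y⁻¹) = 1
    rw [map_mul, map_mul, map_mul, Subgroup.mem_center_iff.1 hyZ (π g), ← map_mul, ← map_mul,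
      ← map_mul, mul_inv_cancel_right, mul_inv_cancel, map_one]
  have hcard : Nat.card (Subgroup.zpowers y) ≤ Nat.card (Subgroup.zpowers x) := by
    simpa using hmax y hnormal
  rw [Subgroup.eq_of_le_of_card_ge hle hcard] at hy1
  exact hy1 (Subgroup.mem_zpowers y)

/-- The structure of a group with a cyclic subgroup of index two inverted by an element of order
four outside it. -/
theorem nonempty_mulEquiv_quaternionGroup {n : ℕ} {x y : G} (hx : orderOf x = 2 * n)
    (hxy : y * x * y⁻¹ = x⁻¹) (hy2 : y ^ 2 = x ^ n) (hy : y ∉ Subgroup.zpowers x)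
    (hxy' : ∀ g, g ∉ Subgroup.zpowers x → g * y⁻¹ ∈ Subgroup.zpowers x) :
    Nonempty (G ≃* QuaternionGroup n) := by
  let E : ZMod (2 * n) →+ Additive G := ZMod.lift (2 * n) ⟨zmultiplesHom (Additive G) (.ofMul x),
    by
      rw [zmultiplesHom_apply, natCast_zsmul, ← ofMul_pow, ← hx, pow_orderOf_eq_one, ofMul_one]⟩
  let e : Multiplicative (ZMod (2 * n)) →* G := E.toMultiplicativeLeft
  have he (i : ℤ) : e (.ofAdd (i : ZMod (2 * n))) = x ^ i :=
    congrArg Additive.toMul (ZMod.lift_coe _ _ i)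
  have hconj (i) : y * e i * y⁻¹ = (e i)⁻¹ := by
    obtain ⟨i, rfl⟩ := ZMod.intCast_surjective i
    erw [he]
    rw [← conj_zpow, hxy, inv_zpow]
  have hn : e (.ofAdd (n : ZMod (2 * n))) = y ^ 2 := by
    rw [hy2]; exact_mod_cast he n
  have hmem (i) : e i ∈ Subgroup.zpowers x := by
    obtain ⟨i, rfl⟩ := ZMod.intCast_surjective i
    exact ⟨i, (he i).symm⟩
  have hswap (i) : e i * y = y * (e i)⁻¹ := by
    have h := hconj i⁻¹
    rw [map_inv, inv_inv, mul_inv_eq_iff_eq_mul] at h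
    exact h.symm
  let φ : QuaternionGroup n →* G := MonoidHom.mk' (fun
    | .a i => e (.ofAdd i)
    | .xa i => y * e (.ofAdd i)) (by
      rintro (i | i) (j | j)
      · simp
      · change y * e (.ofAdd (j - i)) = e (.ofAdd i) * (y * e (.ofAdd j))
        rw [← mul_assoc, hswap, sub_eq_neg_add, ofAdd_add, map_mul, ofAdd_neg, map_inv, mul_assoc]
      · simp [mul_assoc]
      · change e (.ofAdd (n + j - i)) = y * e (.ofAdd i) * (y * e (.ofAdd j))
        rw [add_sub_assoc, sub_eq_neg_add, ofAdd_add, ofAdd_add, map_mul, map_mul, hn, ofAdd_neg,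
          map_inv, mul_assoc y, ← mul_assoc _ y, hswap, sq]
        simp only [mul_assoc])
  refine ⟨(MulEquiv.ofBijective φ ⟨?_, fun g => ?_⟩).symm⟩
  · rw [injective_iff_map_eq_one]
    rintro (i | i) h
    · obtain ⟨i, rfl⟩ := ZMod.intCast_surjective i
      have h1 : x ^ i = 1 := (he i).symm.trans h
      rw [← orderOf_dvd_iff_zpow_eq_one, hx] at h1
      rw [QuaternionGroup.one_def, (ZMod.intCast_zmod_eq_zero_iff_dvd i _).2 h1]
    · exact (hy (eq_inv_of_mul_eq_one_left h ▸ inv_mem (hmem _))).elim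
  · by_cases hg : g ∈ Subgroup.zpowers x
    · obtain ⟨i, rfl⟩ := hg
      exact ⟨.a i, he i⟩
    · obtain ⟨i, hi⟩ := hxy' g hg
      refine ⟨.xa (-i : ℤ), ?_⟩
      change y * e _ = g
      rw [he, zpow_neg, ← he, ← hswap, he]
      simp_all

/-- A finite `2`-group with at most one involution is cyclic or generalized quaternion. -/
theorem UniqueInvolution.isCyclic_or_quaternion [Finite G] (hG : UniqueInvolution G)
    (h2 : IsPGroup 2 G) :
    IsCyclic G ∨ ∃ k : ℕ, 3 ≤ k ∧ Nonempty (G ≃* QuaternionGroup (2 ^ (k - 2))) := by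
  obtain ⟨x, hnormal, hC⟩ := hG.exists_zpowers_normal_centralizer_le h2
  by_cases htop : ∀ g, g ∈ Subgroup.zpowers x
  · exact .inl ⟨x, htop⟩
  push Not at htop
  obtain ⟨m, hx⟩ := (IsPGroup.iff_orderOf.1 h2) x
  have hcent {g : G} (hg : g * x * g⁻¹ = x) : g ∈ Subgroup.zpowers x := by
    refine hC (Subgroup.mem_centralizer_iff.2 ?_)
    rintro _ ⟨i, rfl⟩
    exact (show Commute g x from mul_inv_eq_iff_eq_mul.1 hg).zpow_right i |>.symm
  have hconj (g : G) : ∃ r : ℤ, g * x * g⁻¹ = x ^ r :=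
    (hnormal.conj_mem x (Subgroup.mem_zpowers x) g).imp fun _ h => h.symm
  have hm : 1 ≤ m := by
    by_contra hm
    obtain rfl : m = 0 := by omega
    obtain ⟨g, hg⟩ := htop
    exact hg (hcent (by simp [orderOf_eq_one_iff.1 (hx.trans (pow_zero 2))]))
  have hinv {y : G} (hy : y ∉ Subgroup.zpowers x) (hy2 : y ^ 2 ∈ Subgroup.zpowers x) :
      2 ≤ m ∧ y * x * y⁻¹ = x⁻¹ ∧ y ^ 2 = x ^ 2 ^ (m - 1) := by
    obtain ⟨s, hs⟩ := hy2
    obtain ⟨r, hr⟩ := hconj y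
    replace hs : x ^ s = y ^ 2 := hs
    refine (hG.odd_or_inverts hm hx hy hr hs.symm).resolve_left fun hodd => hy (hcent ?_)
    obtain ⟨i, hi⟩ := mem_zpowers_zpow_of_odd hx hodd
    have : Commute y x := by
      rw [← hi]
      change Commute y ((x ^ s) ^ i)
      rw [hs]
      exact ((Commute.refl y).pow_right 2).zpow_right i
    rw [this.eq, mul_inv_cancel_right]
  have hfour {g : G} (hg : g ^ 4 ∈ Subgroup.zpowers x) : g ^ 2 ∈ Subgroup.zpowers x := by
    by_contra hg2
    obtain ⟨hm2, h, -⟩ := hinv hg2 (by rwa [← pow_mul])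
    obtain ⟨r, hr⟩ := hconj g
    rw [sq_conj_eq_zpow_mul_self hr, eq_inv_iff_mul_eq_one, ← zpow_add_one,
      ← orderOf_dvd_iff_zpow_eq_one, hx] at h
    have h4 : (4 : ℤ) ∣ r * r + 1 := by
      refine Dvd.dvd.trans ?_ h
      exact_mod_cast pow_dvd_pow 2 hm2
    obtain h0 | h0 | h0 | h0 : r % 4 = 0 ∨ r % 4 = 1 ∨ r % 4 = 2 ∨ r % 4 = 3 := by omega
    all_goals
      have := Int.emod_eq_zero_of_dvd h4
      simp [Int.add_emod, Int.mul_emod, h0] at this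
  have hsq (g : G) : g ^ 2 ∈ Subgroup.zpowers x := by
    obtain ⟨n, hn⟩ := h2 g
    have (n : ℕ) (h : g ^ 2 ^ (n + 1) ∈ Subgroup.zpowers x) : g ^ 2 ∈ Subgroup.zpowers x := by
      induction n with
      | zero => simpa using h
      | succ n ih =>
        refine ih ?_
        rw [pow_succ, pow_mul]
        exact hfour (by rw [← pow_mul]; convert h using 2; ring)
    exact this n (by rw [pow_succ, pow_mul, hn, one_pow]; exact one_mem _)
  obtain ⟨y, hy⟩ := htop
  obtain ⟨hm2, hyx, hy2⟩ := hinv hy (hsq y)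
  refine .inr ⟨m + 1, by omega, ?_⟩
  rw [show m + 1 - 2 = m - 1 by omega]
  refine nonempty_mulEquiv_quaternionGroup (hx.trans ?_) hyx hy2 hy fun g hg => hcent ?_
  · rw [← pow_succ', Nat.sub_add_cancel hm]
  · have hy' : y⁻¹ * x * y = x⁻¹ := by
      calc y⁻¹ * x * y = y⁻¹ * x⁻¹⁻¹ * y := by rw [inv_inv]
        _ = y⁻¹ * (y * x * y⁻¹)⁻¹ * y := by rw [hyx]
        _ = x⁻¹ := by group
    calc g * y⁻¹ * x * (g * y⁻¹)⁻¹ = g * (y⁻¹ * x * y) * g⁻¹ := by group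
      _ = x := by rw [hy', ← conj_inv, (hinv hg (hsq g)).2.1, inv_inv]

/-- In a finite `2`-group with property `L_2`, there is at most one involution. -/
theorem HasLp.uniqueInvolution [Finite G] (h2 : IsPGroup 2 G) (hL : HasLp 2 G) :
    UniqueInvolution G := by
  have hinv {a : G} (ha : orderOf a = 2) : a * a = 1 ∧ a ≠ 1 :=
    ⟨by rw [← sq, ← ha, pow_orderOf_eq_one], by rintro rfl; simp at ha⟩
  intro a b ha hb
  obtain ⟨z, -, hz, hz2⟩ := h2.exists_mem_center_orderOf_eq (N := ⊤) fun h =>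
    (hinv ha).2 (Subgroup.mem_bot.1 (h ▸ Subgroup.mem_top a))
  have key {c : G} (hc : orderOf c = 2) : c = z :=
    hL.eq_of_commute_of_mul_self_eq_one (hinv hc).1 (hinv hz2).1
      (Subgroup.mem_center_iff.1 hz c) (hinv hc).2 (hinv hz2).2
  rw [key ha, key hb]

end UniqueInvolution

/-- a finite `2`-group with property `L_2` is cyclic or generalized
quaternion `Q_{2^k}`, `k ≥ 3`. -/
theorem two_group_hasL2_cyclic_or_quaternion (G : Type*) [Group G] [Finite G]
    (hG : IsPGroup 2 G) (hL : HasLp 2 G) :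
    IsCyclic G ∨ ∃ k : ℕ, 3 ≤ k ∧ Nonempty (G ≃* QuaternionGroup (2 ^ (k - 2))) := by
  exact (HasLp.uniqueInvolution hG hL).isCyclic_or_quaternion hG
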